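/- arXiv:1704.01927 — 3 statements merged into one kernel-verified Lean document; each statement's English description precedes it below -/
import Mathlib

section
/- Let V be a finite rooted tree with root r, parent function p and an arbitrary transmission schedule S. Then for every integer i ≥ 1 and every positive integer τ, the number of nodes at level i that reach r within time τ is at most τ^i / i! (as a real number); moreover, if τ < i this number is 0. -/
/-- A node `u` reaches the root `r` within time `τ` (along the `p`-iterate path
`u = u₀, u₁ = p u₀, …, u_k = r` of length `k`): there exist rounds
`t₀ < t₁ < ⋯ < t_{k-1} ≤ τ` (positive integers) such that for each `j < k`,
`t_j ∈ S(u_j)`, `t_j ∉ S(u_{j+1})`, and `t_j ∉ S(w)` for every node `w ≠ u_j`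
with `p w = u_{j+1}`. -/
def Reaches {V : Type*} (p : V → V) (S : V → Set ℕ) (u : V) (k τ : ℕ) : Prop :=
  ∃ t : Fin k → ℕ,
    StrictMono t ∧
    (∀ j : Fin k, 0 < t j ∧ t j ≤ τ) ∧
    (∀ j : Fin k,
      t j ∈ S (p^[(j : ℕ)] u) ∧
      t j ∉ S (p^[(j : ℕ) + 1] u) ∧
      ∀ w : V, w ≠ p^[(j : ℕ)] u → p w = p^[(j : ℕ) + 1] u → t j ∉ S w)

/-- Two nodes with the same `k`-th ancestor coincide if the same rounds carry both of them
there: siblings on the two paths cannot transmit successfully in the same round. -/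
theorem eq_of_common_rounds {V : Type*} {p : V → V} {S : V → Set ℕ} {u v : V} {k : ℕ}
    {t : Fin k → ℕ}
    (hu : ∀ j : Fin k, ∀ w : V, w ≠ p^[(j : ℕ)] u → p w = p^[(j : ℕ) + 1] u → t j ∉ S w)
    (hv : ∀ j : Fin k, t j ∈ S (p^[(j : ℕ)] v))
    (h : p^[k] u = p^[k] v) : u = v := by
  induction k with
  | zero => exact h
  | succ k ih =>
    refine ih (t := fun j => t j.castSucc) (fun j => hu j.castSucc) (fun j => hv j.castSucc) ?_
    by_contra hne
    refine hu (Fin.last k) (p^[k] v) (Ne.symm hne) ?_ (hv (Fin.last k))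
    rw [← Function.iterate_succ_apply' p k v]
    exact h.symm

/-- At most `τ.choose k` nodes with `k`-th ancestor `r` reach `r` within time `τ`. -/
theorem ncard_reaches_le_choose {V : Type*} (p : V → V) (S : V → Set ℕ) (r : V) (k τ : ℕ) :
    {u : V | p^[k] u = r ∧ Reaches p S u k τ}.ncard ≤ τ.choose k := by
  have hex : ∀ u : V, Reaches p S u k τ → ∃ t : Fin k → ℕ,
      StrictMono t ∧ (∀ j : Fin k, 0 < t j ∧ t j ≤ τ) ∧
      (∀ j : Fin k, t j ∈ S (p^[(j : ℕ)] u) ∧ t j ∉ S (p^[(j : ℕ) + 1] u) ∧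
        ∀ w : V, w ≠ p^[(j : ℕ)] u → p w = p^[(j : ℕ) + 1] u → t j ∉ S w) :=
    fun _ h => h
  choose! t ht using hex
  have hcard : ((Finset.Icc 1 τ).powersetCard k : Set (Finset ℕ)).ncard = τ.choose k := by
    rw [Set.ncard_coe_finset, Finset.card_powersetCard, Nat.card_Icc, Nat.add_sub_cancel]
  rw [← hcard]
  refine Set.ncard_le_ncard_of_injOn (fun u => Finset.univ.image (t u)) ?_ ?_
    (Finset.finite_toSet _)
  · rintro u ⟨-, hu⟩
    obtain ⟨hmono, hbound, -⟩ := ht u hu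
    refine Finset.mem_coe.2 (Finset.mem_powersetCard.2 ⟨?_, ?_⟩)
    · exact Finset.image_subset_iff.2 fun j _ => Finset.mem_Icc.2 (hbound j)
    · rw [Finset.card_image_of_injective _ hmono.injective, Finset.card_fin]
  · rintro u ⟨hur, hu⟩ v ⟨hvr, hv⟩ huv
    obtain ⟨hmu, -, hu⟩ := ht u hu
    obtain ⟨hmv, -, hv⟩ := ht v hv
    have htt : t u = t v := by
      refine (StrictMono.range_inj hmu hmv).1 ?_
      simpa using congrArg (fun s : Finset ℕ => (s : Set ℕ)) huv
    exact eq_of_common_rounds (fun j => (hu j).2.2) (fun j => htt ▸ (hv j).1) (hur.trans hvr.symm)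

/-- Let `V` be a finite rooted tree with root `r`, parent function `p`
(`p r = r`, every node has some iterate of `p` equal to `r`), let `lev` be
the level function (`lev v` is the least `n` with `p^[n] v = r`), and let `S`
be an arbitrary transmission schedule. Then for every integer `i ≥ 1` and
every positive integer `τ`, the number of nodes at level `i` that reach `r`
within time `τ` is at most `τ^i / i!` (as a real number); moreover, if
`τ < i` this number is `0`. -/
theorem stmt_1 {V : Type*} [Fintype V] (r : V) (p : V → V)
    (hr : p r = r) (hroot : ∀ v : V, ∃ n : ℕ, p^[n] v = r)
    (lev : V → ℕ)
    (hlev : ∀ v : V, p^[lev v] v = r ∧ ∀ m : ℕ, m < lev v → p^[m] v ≠ r)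
    (S : V → Set ℕ) (i τ : ℕ) (hi : 1 ≤ i) (hτ : 1 ≤ τ) :
    (({u : V | lev u = i ∧ Reaches p S u i τ}.ncard : ℝ)
        ≤ (τ : ℝ) ^ i / (Nat.factorial i : ℝ)) ∧
    (τ < i → {u : V | lev u = i ∧ Reaches p S u i τ} = ∅) := by
  have hle : {u : V | lev u = i ∧ Reaches p S u i τ}.ncard ≤ τ.choose i := by
    refine (Set.ncard_le_ncard ?_ (Set.toFinite _)).trans (ncard_reaches_le_choose p S r i τ)
    rintro u ⟨rfl, hu⟩
    exact ⟨(hlev u).1, hu⟩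
  refine ⟨(Nat.cast_le.2 hle).trans (Nat.choose_le_pow_div i τ), fun h => ?_⟩
  rw [Nat.choose_eq_zero_of_lt h, Nat.le_zero] at hle
  exact (Set.ncard_eq_zero (Set.toFinite _)).1 hle
end

section
/- For every real number c > 1 and every integer Δ ≥ 3, there exists D₀ such that for every even integer D ≥ D₀, setting h₁ = ⌊(D + 8c − 6)/(8c)⌋ (floor of a real number), one has (2·(log₂ Δ)^c)^{h₁ − 1} < ((Δ−1)^{D/2 − 2} − 2)^{Δ−1}. -/
theorem Real.logb_two_natCast_le_sub_one {n : ℕ} (hn : 1 ≤ n) :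
    Real.logb 2 (n : ℝ) ≤ (n : ℝ) - 1 := by
  obtain ⟨k, rfl⟩ := Nat.exists_eq_add_of_le' hn
  have hlt : ((k + 1 : ℕ) : ℝ) ≤ 2 ^ k := by
    exact_mod_cast Nat.succ_le_of_lt Nat.lt_two_pow_self
  have hpos : (0 : ℝ) < ((k + 1 : ℕ) : ℝ) := by positivity
  rw [Real.logb_le_iff_le_rpow one_lt_two hpos]
  have hcast : ((k + 1 : ℕ) : ℝ) - 1 = (k : ℝ) := by push_cast; ring
  rwa [hcast, Real.rpow_natCast]

/-- The number of labels is dominated by a power of `Δ - 1`. -/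
theorem two_mul_logb_rpow_le {c : ℝ} (hc : 1 < c) {Δ : ℕ} (hΔ : 3 ≤ Δ) :
    2 * Real.logb 2 (Δ : ℝ) ^ c ≤ ((Δ : ℝ) - 1) ^ (2 * c) := by
  have hΔ' : (3 : ℝ) ≤ Δ := by exact_mod_cast hΔ
  have hL0 : 0 ≤ Real.logb 2 (Δ : ℝ) := Real.logb_nonneg one_lt_two (by linarith)
  have hL : Real.logb 2 (Δ : ℝ) ≤ (Δ : ℝ) - 1 :=
    Real.logb_two_natCast_le_sub_one (by omega)
  calc 2 * Real.logb 2 (Δ : ℝ) ^ c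
      ≤ 2 ^ c * Real.logb 2 (Δ : ℝ) ^ c := by
        gcongr
        exact Real.self_le_rpow_of_one_le one_le_two hc.le
    _ ≤ ((Δ : ℝ) - 1) ^ c * ((Δ : ℝ) - 1) ^ c := by
        have hq : (2 : ℝ) ≤ (Δ : ℝ) - 1 := by linarith
        have hq0 : (0 : ℝ) ≤ (Δ : ℝ) - 1 := by linarith
        gcongr
    _ = ((Δ : ℝ) - 1) ^ (2 * c) := by
        rw [← Real.rpow_add (by linarith), two_mul]

theorem pow_lt_pow_succ_sub_two {q : ℝ} (hq : 2 ≤ q) {j : ℕ} (hj : 2 ≤ j) :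
    q ^ j < q ^ (j + 1) - 2 := by
  have h4 : (4 : ℝ) ≤ q ^ j := by
    calc (4 : ℝ) = 2 ^ 2 := by norm_num
      _ ≤ q ^ 2 := by gcongr
      _ ≤ q ^ j := pow_le_pow_right₀ (by linarith) hj
  rw [pow_succ]
  nlinarith

/-- For every real `c > 1` and every integer `Δ ≥ 3`, there exists `D₀` such
that for every even integer `D ≥ D₀`, setting `h₁ = ⌊(D + 8c - 6)/(8c)⌋`
(floor of a real number), one has
`(2·(log₂ Δ)^c)^{h₁-1} < ((Δ-1)^{D/2-2} - 2)^{Δ-1}`,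
where `(log₂ Δ)^c` is a real (rpow) power and the outer exponents `h₁ - 1`
and `Δ - 1` are natural-number exponents. -/
theorem stmt_7 (c : ℝ) (hc : 1 < c) (Δ : ℕ) (hΔ : 3 ≤ Δ) :
    ∃ D₀ : ℕ, ∀ D : ℕ, D₀ ≤ D → Even D →
      (2 * Real.logb 2 (Δ : ℝ) ^ c) ^ (⌊((D : ℝ) + 8 * c - 6) / (8 * c)⌋₊ - 1)
        < (((Δ : ℝ) - 1) ^ (D / 2 - 2) - 2) ^ (Δ - 1) := by
  refine ⟨10, fun D hD hDeven => ?_⟩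
  obtain ⟨j, hj⟩ : ∃ j, D = 2 * (j + 3) := by
    obtain ⟨m, hm⟩ := hDeven
    exact ⟨m - 3, by omega⟩
  have hj2 : 2 ≤ j := by omega
  have hexp : D / 2 - 2 = j + 1 := by omega
  have hDj : (D : ℝ) = 2 * ((j : ℝ) + 3) := by rw [hj]; push_cast; ring
  have hq : (2 : ℝ) ≤ (Δ : ℝ) - 1 := by
    have : (3 : ℝ) ≤ Δ := by exact_mod_cast hΔ
    linarith
  have hL0 : 0 ≤ Real.logb 2 (Δ : ℝ) := Real.logb_nonneg one_lt_two (by linarith)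
  have hc0 : 0 < c := by linarith
  set n := ⌊((D : ℝ) + 8 * c - 6) / (8 * c)⌋₊ - 1 with hn
  have hfloor : 2 * c * (n : ℝ) ≤ j := by
    have heq : ((D : ℝ) + 8 * c - 6) / (8 * c) = (j : ℝ) / (4 * c) + 1 := by
      rw [hDj]
      field_simp
      ring
    have hn' : n = ⌊(j : ℝ) / (4 * c)⌋₊ := by
      rw [hn, heq, Nat.floor_add_one (by positivity), Nat.add_sub_cancel]
    have hle : (n : ℝ) ≤ (j : ℝ) / (4 * c) := hn' ▸ Nat.floor_le (by positivity)
    rw [le_div_iff₀ (by positivity)] at hle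
    have : (0 : ℝ) ≤ n * c := by positivity
    linarith
  have hlt := pow_lt_pow_succ_sub_two hq hj2
  have hone : (1 : ℝ) ≤ ((Δ : ℝ) - 1) ^ j := one_le_pow₀ (by linarith)
  rw [hexp]
  calc (2 * Real.logb 2 (Δ : ℝ) ^ c) ^ n
      ≤ (((Δ : ℝ) - 1) ^ (2 * c)) ^ n :=
        pow_le_pow_left₀ (by positivity) (two_mul_logb_rpow_le hc hΔ) n
    _ = ((Δ : ℝ) - 1) ^ (2 * c * n) := by
        rw [← Real.rpow_natCast, ← Real.rpow_mul (by linarith)]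
    _ ≤ ((Δ : ℝ) - 1) ^ (j : ℝ) := Real.rpow_le_rpow_of_exponent_le (by linarith) hfloor
    _ = ((Δ : ℝ) - 1) ^ j := Real.rpow_natCast _ _
    _ < ((Δ : ℝ) - 1) ^ (j + 1) - 2 := hlt
    _ ≤ (((Δ : ℝ) - 1) ^ (j + 1) - 2) ^ (Δ - 1) :=
        le_self_pow₀ (by linarith) (by omega)
end

section
/- For every real number c > 0 and every integer D ≥ 4, there exists Δ₀ such that for every real Δ ≥ Δ₀ and every real τ with 0 ≤ τ ≤ Δ/(8·(log₂ Δ)^c), one has (2·(log₂ Δ)^c)^{D−1+τ} · 2^{2·τ·(log₂ Δ)^c} < 2^{Δ/2 − 1}. -/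
/-- For every real `c > 0` and every integer `D ≥ 4`, there exists `Δ₀` such
that for every real `Δ ≥ Δ₀` and every real `τ` with
`0 ≤ τ ≤ Δ/(8·(log₂ Δ)^c)`, one has
`(2·(log₂ Δ)^c)^{D-1+τ} · 2^{2·τ·(log₂ Δ)^c} < 2^{Δ/2 - 1}`,
all powers with real exponents being real (rpow) powers. -/
theorem stmt_9 (c : ℝ) (hc : 0 < c) (D : ℕ) (hD : 4 ≤ D) :
    ∃ Δ₀ : ℝ, ∀ Δ : ℝ, Δ₀ ≤ Δ → ∀ τ : ℝ, 0 ≤ τ →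
      τ ≤ Δ / (8 * Real.logb 2 Δ ^ c) →
      (2 * Real.logb 2 Δ ^ c) ^ ((D : ℝ) - 1 + τ)
          * (2 : ℝ) ^ (2 * τ * Real.logb 2 Δ ^ c)
        < (2 : ℝ) ^ (Δ / 2 - 1) := by
  have hlogb : (fun x : ℝ => Real.logb 2 x) =o[Filter.atTop] (id : ℝ → ℝ) :=
    Real.isLittleO_logb_id_atTop
  have hL : Filter.Tendsto (fun x : ℝ => Real.logb 2 x) Filter.atTop Filter.atTop :=
    Real.tendsto_logb_atTop (by norm_num)
  have hP : Filter.Tendsto (fun x : ℝ => 2 * Real.logb 2 x ^ c) Filter.atTop Filter.atTop :=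
    ((tendsto_rpow_atTop hc).comp hL).const_mul_atTop (by norm_num)
  have hD0 : (4 : ℝ) ≤ D := by exact_mod_cast hD
  have hK : 0 < 32 * (D : ℝ) * (1 + c) := by positivity
  have h₁ := hP.eventually (hlogb.bound (show (0 : ℝ) < 1 / 4 by norm_num))
  have h₂ := hL.eventually (hlogb.bound (show (0 : ℝ) < 1 by norm_num))
  have h₃ := hlogb.bound (show (0 : ℝ) < 1 / (32 * (D : ℝ) * (1 + c)) by positivity)
  obtain ⟨Δ₀, h⟩ := Filter.eventually_atTop.1
    (h₁.and (h₂.and (h₃.and ((hL.eventually_ge_atTop 1).and (Filter.eventually_ge_atTop 100)))))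
  refine ⟨Δ₀, fun Δ hΔ τ hτ hτΔ => ?_⟩
  obtain ⟨h₁, h₂, h₃, hL1, hΔ1⟩ := h Δ hΔ
  have hE : Real.logb 2 (2 * Real.logb 2 Δ ^ c) = 1 + c * Real.logb 2 (Real.logb 2 Δ) := by
    rw [Real.logb_mul (by norm_num) (by positivity), Real.logb_rpow_eq_mul_logb_of_pos
      (by linarith), Real.logb_self_eq_one (by norm_num)]
  have hP0 : 0 < Real.logb 2 Δ ^ c := by positivity
  simp only [id, Real.norm_eq_abs] at h₁ h₂ h₃
  have h₁ := (le_abs_self _).trans h₁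
  have h₂ := (le_abs_self _).trans h₂
  have h₃ := (le_abs_self _).trans h₃
  rw [abs_of_pos (by positivity)] at h₁ h₂ h₃
  rw [one_div, inv_mul_eq_div, le_div_iff₀ hK] at h₃
  rw [le_div_iff₀ (by positivity)] at hτΔ
  have hY : 2 * Real.logb 2 Δ ^ c = (2 : ℝ) ^ Real.logb 2 (2 * Real.logb 2 Δ ^ c) :=
    (Real.rpow_logb (by norm_num) (by norm_num) (by positivity)).symm
  have hτE := mul_le_mul_of_nonneg_left h₁ hτ
  have hDE : ((D : ℝ) - 1) * Real.logb 2 (2 * Real.logb 2 Δ ^ c) ≤ Δ / 32 := by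
    rw [hE]
    calc ((D : ℝ) - 1) * (1 + c * Real.logb 2 (Real.logb 2 Δ))
        ≤ ((D : ℝ) - 1) * ((1 + c) * Real.logb 2 Δ) := by
          refine mul_le_mul_of_nonneg_left ?_ (by linarith)
          have := mul_le_mul_of_nonneg_left h₂ hc.le
          linarith
      _ ≤ D * ((1 + c) * Real.logb 2 Δ) :=
          mul_le_mul_of_nonneg_right (by linarith) (by positivity)
      _ ≤ Δ / 32 := by linarith
  rw [show (2 * Real.logb 2 Δ ^ c) ^ ((D : ℝ) - 1 + τ) =
      (2 : ℝ) ^ (Real.logb 2 (2 * Real.logb 2 Δ ^ c) * ((D : ℝ) - 1 + τ)) by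
    rw [Real.rpow_mul (by norm_num), ← hY], ← Real.rpow_add (by norm_num)]
  apply Real.rpow_lt_rpow_of_exponent_lt (by norm_num)
  linarith
end
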